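/- For $h\in(0,1/2]$ and $q\in(0,1]$ let $c_k(h,q)=\sqrt{1-\exp\big(-\tfrac{2h^2}{1-h}(qk^2+\tfrac{1}{q})\big)}\,\exp\big(-hqk^2-\tfrac{h}{q}\big)$ for $k\in\mathbb{Z}$. Then for every fixed $q\in(0,1]$ there exist constants $K>0$ and $h_0\in(0,1/2]$ such that for all $h\in(0,h_0)$: $\Big|\sum_{k\in\mathbb{Z}}c_k(h,q)\,c_{k+1}(h,q) - \frac{e^{-2h/q-hq/2}}{1-h}\sqrt{\frac{\pi}{8q}}\Big(\sqrt{h}+\frac{(1-h)(16-4q^2)-3q}{4q(1-h)}\,h^{3/2}\Big)\Big| \le K\,h^2|\ln h|$. -/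

import Mathlib

open Filter

noncomputable section

/-- The coefficients `c_k(h,q) = √(1-exp(-(2h²/(1-h))(qk²+1/q)))·exp(-hqk²-h/q)`. -/
def ck (h q : ℝ) (k : ℤ) : ℝ :=
  Real.sqrt (1 - Real.exp (-(2 * h ^ 2 / (1 - h) * (q * (k:ℝ) ^ 2 + 1 / q)))) *
    Real.exp (-(h * q * (k:ℝ) ^ 2) - h / q)


lemma aux_summable_half : Summable fun k : ℤ => 1 / (1 + ((k:ℝ) + 1/2)^2) := by
  have h := (Real.summable_one_div_int_add_rpow (1/2) 2).2 (by norm_num)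
  refine Summable.of_nonneg_of_le (fun k => by positivity) (fun k => ?_) h
  have h0 : ((k:ℝ) + 1/2) ≠ 0 := by
    intro h0
    have : (2 * k + 1 : ℤ) = 0 := by
      have : (2 * (k:ℝ) + 1) = 0 := by linarith
      exact_mod_cast this
    omega
  have h1 : 0 < ((k:ℝ) + 1/2)^2 := by positivity
  have h2 : |(k:ℝ) + 1/2| ^ (2:ℝ) = ((k:ℝ) + 1/2)^2 := by
    rw [show (2:ℝ) = ((2:ℕ):ℝ) by norm_num, Real.rpow_natCast, sq_abs]
  rw [h2]
  exact one_div_le_one_div_of_le h1 (by linarith)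

lemma aux_pow_exp (j : ℕ) (b t : ℝ) (hb : 0 < b) (ht : 0 < t) :
    t ^ j * Real.exp (-(b * t)) ≤ (j+1).factorial / b ^ (j+1) * (1 / t) := by
  have h := Real.pow_div_factorial_le_exp (b * t) (by positivity) (j+1)
  have hf : (0:ℝ) < (j+1).factorial := by positivity
  rw [Real.exp_neg]
  rw [div_le_iff₀ hf] at h
  have he := Real.exp_pos (b*t)
  rw [← div_eq_mul_inv, div_mul_div_comm, mul_one, div_le_div_iff₀ he (by positivity)]
  calc t ^ j * (b ^ (j+1) * t) = (b*t)^(j+1) := by ring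
    _ ≤ _ := by linarith

lemma aux_gauss_le (j : ℕ) (b m : ℝ) (hb : 0 < b) :
    (1 + m^2) ^ j * Real.exp (-(b * m^2)) ≤
      Real.exp b * ((j+1).factorial / b ^ (j+1)) * (1 / (1 + m^2)) := by
  have h := aux_pow_exp j b (1 + m^2) hb (by positivity)
  have e : Real.exp (-(b * m^2)) = Real.exp b * Real.exp (-(b * (1 + m^2))) := by
    rw [← Real.exp_add]; ring_nf
  rw [e]
  have := mul_le_mul_of_nonneg_left h (Real.exp_pos b).le
  calc _ = Real.exp b * ((1 + m ^ 2) ^ j * Real.exp (-(b * (1 + m ^ 2)))) := by ring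
    _ ≤ _ := this
    _ = _ := by ring

lemma aux_summable0 (a : ℝ) (ha : 0 < a) :
    Summable fun k : ℤ => Real.exp (-(a * ((k:ℝ) + 1/2)^2)) := by
  refine Summable.of_nonneg_of_le (fun k => by positivity) (fun k => ?_)
    (aux_summable_half.mul_left (Real.exp a * ((0+1).factorial / a ^ (0+1))))
  simpa using aux_gauss_le 0 a ((k:ℝ)+1/2) ha

lemma aux_summable2 (a : ℝ) (ha : 0 < a) :
    Summable fun k : ℤ => ((k:ℝ) + 1/2)^2 * Real.exp (-(a * ((k:ℝ) + 1/2)^2)) := by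
  refine Summable.of_nonneg_of_le (fun k => by positivity) (fun k => ?_)
    (aux_summable_half.mul_left (Real.exp a * ((1+1).factorial / a ^ (1+1))))
  refine le_trans ?_ (aux_gauss_le 1 a ((k:ℝ)+1/2) ha)
  have := Real.exp_pos (-(a * ((k:ℝ) + 1/2)^2))
  rw [pow_one]
  nlinarith

lemma aux_g_upper (x : ℝ) (hx : 0 ≤ x) : 1 - Real.exp (-x) ≤ x * (1 - x/2 + x^2/2) := by
  rcases le_total x 1 with h | h
  · have := Real.exp_bound (x := -x) (by rw [abs_neg, abs_of_nonneg hx]; exact h) (n := 3) (by norm_num)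
    rw [abs_neg, abs_of_nonneg hx] at this
    norm_num [Finset.sum_range_succ, Nat.factorial] at this
    have h2 := (abs_le.1 this).1
    have : 0 ≤ x^3 := by positivity
    nlinarith
  · have := Real.exp_pos (-x)
    nlinarith [mul_nonneg (sq_nonneg x) (sub_nonneg.2 h)]

lemma aux_g_lower (x : ℝ) (hx : 0 ≤ x) : x * Real.exp (-(x/2)) ≤ 1 - Real.exp (-x) := by
  have h1 : x/2 ≤ Real.sinh (x/2) := Real.self_le_sinh_iff.2 (by linarith)
  rw [Real.sinh_eq] at h1
  have e1 : Real.exp (-x) = Real.exp (-(x/2)) * Real.exp (-(x/2)) := by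
    rw [← Real.exp_add]; ring_nf
  have e2 : Real.exp (x/2) * Real.exp (-(x/2)) = 1 := by
    rw [← Real.exp_add]; simp
  have := Real.exp_pos (-(x/2))
  rw [e1]
  nlinarith

lemma aux_lower (x y : ℝ) (hx : 0 ≤ x) (hy : 0 ≤ y) :
    Real.sqrt (x * y) * Real.exp (-((x+y)/4)) ≤
      Real.sqrt (1 - Real.exp (-x)) * Real.sqrt (1 - Real.exp (-y)) := by
  have gx := aux_g_lower x hx
  have gy := aux_g_lower y hy
  have hgx : 0 ≤ 1 - Real.exp (-x) := le_trans (by positivity) gx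
  rw [← Real.sqrt_mul hgx]
  apply Real.le_sqrt_of_sq_le
  rw [mul_pow, Real.sq_sqrt (by positivity)]
  have e : Real.exp (-((x+y)/4))^2 = Real.exp (-(x/2)) * Real.exp (-(y/2)) := by
    rw [← Real.exp_add, ← Real.exp_nat_mul]; push_cast; ring_nf
  rw [e]
  calc _ = (x * Real.exp (-(x/2))) * (y * Real.exp (-(y/2))) := by ring
    _ ≤ _ := mul_le_mul gx gy (by positivity) hgx

lemma aux_upper (x y : ℝ) (hx : 0 ≤ x) (hy : 0 ≤ y) :
    Real.sqrt (1 - Real.exp (-x)) * Real.sqrt (1 - Real.exp (-y)) ≤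
    Real.sqrt (x * y) * Real.exp (-((x+y)/4)) + (x+y)^3/8 := by
  have gx := aux_g_upper x hx
  have gy := aux_g_upper y hy
  have hgx : 0 ≤ 1 - Real.exp (-x) := by
    have : Real.exp (-x) ≤ 1 := Real.exp_le_one_iff.2 (by linarith)
    linarith
  have hgy : 0 ≤ 1 - Real.exp (-y) := by
    have : Real.exp (-y) ≤ 1 := Real.exp_le_one_iff.2 (by linarith)
    linarith
  have px : 0 ≤ 1 - x/2 + x^2/2 := by nlinarith [sq_nonneg (x-1/2)]
  have py : 0 ≤ 1 - y/2 + y^2/2 := by nlinarith [sq_nonneg (y-1/2)]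
  set s := Real.sqrt (x*y) with hs
  have s0 : 0 ≤ s := Real.sqrt_nonneg _
  have s2 : s^2 = x*y := Real.sq_sqrt (by positivity)
  have h1 : Real.sqrt (1 - Real.exp (-x)) * Real.sqrt (1 - Real.exp (-y)) ≤
      s * (1 - (x+y)/4 + (x^2+y^2)/4) := by
    rw [← Real.sqrt_mul hgx]
    apply Real.sqrt_le_iff.2
    refine ⟨mul_nonneg s0 (by nlinarith), ?_⟩
    rw [mul_pow, s2]
    calc _ ≤ (x * (1 - x/2 + x^2/2)) * (y * (1 - y/2 + y^2/2)) :=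
          mul_le_mul gx gy hgy (by positivity)
      _ = (x*y) * ((1 - x/2 + x^2/2) * (1 - y/2 + y^2/2)) := by ring
      _ ≤ _ := by
        apply mul_le_mul_of_nonneg_left _ (by positivity)
        nlinarith [sq_nonneg ((1 - x/2 + x^2/2) - (1 - y/2 + y^2/2))]
  have h2 : 1 - (x+y)/4 ≤ Real.exp (-((x+y)/4)) := by
    have := Real.add_one_le_exp (-((x+y)/4)); linarith
  have h3 : s ≤ (x+y)/2 := by
    apply Real.sqrt_le_iff.2
    exact ⟨by positivity, by nlinarith [sq_nonneg (x-y)]⟩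
  have h4 : s * ((x^2+y^2)/4) ≤ (x+y)/2 * ((x+y)^2/4) := by
    apply mul_le_mul h3 _ (by positivity) (by positivity)
    nlinarith [mul_nonneg hx hy]
  nlinarith [mul_le_mul_of_nonneg_left h2 s0]

lemma aux_theta_eq (a : ℝ) (ha : 0 < a) :
    ((∑' k : ℤ, Real.exp (-(a * ((k:ℝ) + 1/2)^2)) : ℝ) : ℂ) =
      ((Real.sqrt Real.pi / Real.sqrt a : ℝ) : ℂ) *
        ∑' n : ℤ, Complex.exp (-((Real.pi^2 / a : ℝ) : ℂ) * n^2 + Complex.I * Real.pi * n) := by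
  have hpi := Real.pi_pos
  have hpc : (Real.pi : ℂ) ≠ 0 := by exact_mod_cast hpi.ne'
  have hac : (a : ℂ) ≠ 0 := by exact_mod_cast ha.ne'
  have key := Complex.tsum_exp_neg_quadratic (a := ((a / Real.pi : ℝ) : ℂ))
    (by rw [Complex.ofReal_re]; positivity) (-((a / Real.pi / 2 : ℝ) : ℂ))
  have e1 : ∀ n : ℤ, Complex.exp (-↑Real.pi * ((a / Real.pi : ℝ) : ℂ) * ↑n ^ 2 +
      2 * ↑Real.pi * (-((a / Real.pi / 2 : ℝ) : ℂ)) * ↑n) =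
      Complex.exp (a/4) * ((Real.exp (-(a * ((n:ℝ) + 1/2)^2)) : ℝ) : ℂ) := by
    intro n
    push_cast
    rw [← Complex.exp_add]
    congr 1
    field_simp
    ring
  have e2 : ∀ n : ℤ, Complex.exp (-↑Real.pi / ((a / Real.pi : ℝ) : ℂ) *
      (↑n + Complex.I * (-((a / Real.pi / 2 : ℝ) : ℂ))) ^ 2) =
      Complex.exp (a/4) *
        Complex.exp (-((Real.pi^2 / a : ℝ) : ℂ) * n^2 + Complex.I * Real.pi * n) := by
    intro n
    push_cast
    rw [← Complex.exp_add]
    congr 1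
    have hI : Complex.I^2 = -1 := Complex.I_sq
    field_simp
    ring_nf
    rw [hI]
    ring
  simp_rw [e1, e2] at key
  rw [tsum_mul_left, tsum_mul_left] at key
  have e3 : (1:ℂ) / ((a / Real.pi : ℝ) : ℂ) ^ (1/2 : ℂ) =
      ((Real.sqrt Real.pi / Real.sqrt a : ℝ) : ℂ) := by
    have : ((a / Real.pi : ℝ) : ℂ) ^ (1/2 : ℂ) = ((Real.sqrt (a / Real.pi) : ℝ) : ℂ) := by
      rw [Real.sqrt_eq_rpow, Complex.ofReal_cpow (by positivity)]
      norm_num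
    rw [this, Real.sqrt_div ha.le]
    push_cast
    rw [one_div_div]
  rw [e3] at key
  have hne : Complex.exp (a/4) ≠ 0 := Complex.exp_ne_zero _
  apply mul_left_cancel₀ hne
  rw [Complex.ofReal_tsum, key]
  ring

lemma aux_theta : ∃ C > 0, ∀ a : ℝ, 0 < a → a ≤ 2 →
    |(∑' k : ℤ, Real.exp (-(a * ((k:ℝ) + 1/2)^2))) - Real.sqrt Real.pi / Real.sqrt a| ≤
      C * a^3 := by
  have hW : Summable fun n : ℤ => 1 / (n:ℝ)^2 := Real.summable_one_div_int_pow.2 (by norm_num)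
  set W := ∑' n : ℤ, 1 / (n:ℝ)^2 with hWd
  have hW0 : 0 ≤ W := tsum_nonneg (fun n => by positivity)
  refine ⟨Real.sqrt Real.pi * (24 * W) * 2 + 1, by positivity, fun a ha ha2 => ?_⟩
  have hpi := Real.pi_pos
  have hpi3 := Real.pi_gt_three
  let f : ℤ → ℂ := fun n =>
    Complex.exp (-((Real.pi^2 / a : ℝ) : ℂ) * n^2 + Complex.I * Real.pi * n)
  have hfn : ∀ n : ℤ, ‖f n‖ = Real.exp (-((Real.pi^2 / a) * (n:ℝ)^2)) := by
    intro n
    simp only [f]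
    rw [Complex.norm_exp]
    congr 1
    have : (-((Real.pi^2 / a : ℝ) : ℂ) * n^2 + Complex.I * Real.pi * n) =
      ((-((Real.pi^2 / a) * (n:ℝ)^2) : ℝ) : ℂ) + ((Real.pi * n : ℝ) : ℂ) * Complex.I := by
      push_cast; ring
    rw [this, Complex.add_re, Complex.ofReal_re, Complex.re_ofReal_mul, Complex.I_re]
    ring
  have hb : ∀ n : ℤ, n ≠ 0 → ‖f n‖ ≤ 24 * a^4 * (1 / (n:ℝ)^2) := by
    intro n hn
    rw [hfn]
    have hn1 : (1:ℝ) ≤ (n:ℝ)^2 := by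
      have : 1 ≤ n^2 := by
        have : 0 < n^2 := by positivity
        omega
      exact_mod_cast this
    have h := aux_pow_exp 3 (1/a) ((Real.pi^2) * (n:ℝ)^2) (by positivity) (by positivity)
    have hp1 : 1 ≤ Real.pi^2 := by nlinarith
    have hN : (n:ℝ)^2 ≤ Real.pi^2 * (n:ℝ)^2 := by nlinarith
    have h1 : 1 ≤ (Real.pi^2 * (n:ℝ)^2)^3 := one_le_pow₀ (by linarith)
    have e : Real.pi^2 / a * (n:ℝ)^2 = 1/a * (Real.pi^2 * (n:ℝ)^2) := by ring
    rw [e]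
    have hp := Real.exp_pos (-(1/a * (Real.pi^2 * (n:ℝ)^2)))
    calc Real.exp (-(1/a * (Real.pi^2 * (n:ℝ)^2))) ≤
        (Real.pi^2 * (n:ℝ)^2)^3 * Real.exp (-(1/a * (Real.pi^2 * (n:ℝ)^2))) := by nlinarith
      _ ≤ _ := h
      _ = 24 * a^4 * (1 / (Real.pi^2 * (n:ℝ)^2)) := by
        norm_num [Nat.factorial]
      _ ≤ _ := by
        apply mul_le_mul_of_nonneg_left _ (by positivity)
        exact one_div_le_one_div_of_le (by linarith) hN
  have hg : Summable fun n : ℤ => 24 * a^4 * (1 / (n:ℝ)^2) := hW.mul_left _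
  have hb' : ∀ n : ℤ, ‖if n = 0 then 0 else f n‖ ≤ 24 * a^4 * (1 / (n:ℝ)^2) := by
    intro n
    split_ifs with h
    · simp [h]
    · exact hb n h
  have hs' : Summable fun n : ℤ => if n = 0 then 0 else f n := Summable.of_norm_bounded hg hb'
  have hs : Summable f := by
    refine Summable.of_norm_bounded_eventually hg ?_
    rw [Filter.eventually_cofinite]
    refine (Set.finite_singleton (0:ℤ)).subset ?_
    intro n hn
    by_contra h
    exact hn (hb n h)
  have hsplit := hs.tsum_eq_add_tsum_ite 0
  have hf0 : f 0 = 1 := by simp [f]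
  have htail : ‖∑' n : ℤ, if n = 0 then 0 else f n‖ ≤ 24 * a^4 * W := by
    rw [hWd, ← tsum_mul_left]
    exact tsum_of_norm_bounded hg.hasSum hb'
  have key := aux_theta_eq a ha
  change _ = _ * ∑' n, f n at key
  rw [hsplit, hf0] at key
  have hsa : 0 < Real.sqrt a := Real.sqrt_pos.2 ha
  have : (((∑' k : ℤ, Real.exp (-(a * ((k:ℝ) + 1/2)^2))) - Real.sqrt Real.pi / Real.sqrt a : ℝ) : ℂ)
      = ((Real.sqrt Real.pi / Real.sqrt a : ℝ) : ℂ) * ∑' n : ℤ, if n = 0 then 0 else f n := by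
    rw [Complex.ofReal_sub, key]; ring
  rw [← Real.norm_eq_abs, ← Complex.norm_real, this, norm_mul, Complex.norm_real,
    Real.norm_of_nonneg (by positivity)]
  have ha1 : a / Real.sqrt a ≤ 2 := by
    rw [Real.div_sqrt]
    apply Real.sqrt_le_iff.2
    constructor <;> linarith
  calc _ ≤ Real.sqrt Real.pi / Real.sqrt a * (24 * a^4 * W) :=
        mul_le_mul_of_nonneg_left htail (by positivity)
    _ = (Real.sqrt Real.pi * (24 * W) * a^3) * (a / Real.sqrt a) := by ring
    _ ≤ (Real.sqrt Real.pi * (24 * W) * a^3) * 2 :=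
        mul_le_mul_of_nonneg_left ha1 (by positivity)
    _ ≤ _ := by nlinarith [pow_pos ha 3]

lemma aux_inv_sqrt (a d : ℝ) (ha : 0 < a) (ha1 : a ≤ 1) (hd : d ≤ a^3/2) (hd' : -(a^3/2) ≤ d) :
    |1 / Real.sqrt (a - d) - 1 / Real.sqrt a - d / (2 * (a * Real.sqrt a))| ≤ |d| * 6 := by
  have h3 : a^3 ≤ a := by nlinarith [mul_nonneg ha.le (sub_nonneg.2 ha1), mul_nonneg (sq_nonneg a) (sub_nonneg.2 ha1)]
  have hp : a/4 ≤ a - d := by linarith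
  set s := Real.sqrt a with hs
  set t := Real.sqrt (a - d) with ht
  have s0 : 0 < s := Real.sqrt_pos.2 ha
  have t0 : 0 < t := Real.sqrt_pos.2 (by linarith)
  have s2 : s^2 = a := Real.sq_sqrt ha.le
  have t2 : t^2 = a - d := Real.sq_sqrt (by linarith)
  have hts : s / 2 ≤ t := by
    apply Real.le_sqrt_of_sq_le
    rw [div_pow, s2]; linarith
  have hd2 : d = (s - t) * (s + t) := by rw [← sub_eq_of_eq_add' (show a = (a-d) + d by ring), ← s2]; nlinarith
  have e : 1 / t - 1 / s - d / (2 * (a * s)) = d * (d * (2*s+t) / (2 * s^3 * t * (s+t)^2)) := by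
    rw [← s2, hd2]
    field_simp
    ring
  rw [e, abs_mul]
  apply mul_le_mul_of_nonneg_left _ (abs_nonneg d)
  have hs1 : s ≤ 1 := by
    apply Real.sqrt_le_iff.2; constructor <;> linarith
  have hda : |d| ≤ s^6/2 := by
    rw [abs_le]; have : s^6 = a^3 := by rw [← s2]; ring
    rw [this]; exact ⟨hd', hd⟩
  rw [abs_div, abs_mul, abs_of_pos (show 0 < 2*s+t by positivity),
    abs_of_pos (show 0 < 2 * s^3 * t * (s+t)^2 by positivity), div_le_iff₀ (by positivity)]
  have h1 : |d| * (2*s+t) ≤ s^6/2 * (2*(s+t)) := by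
    apply mul_le_mul hda (by linarith) (by positivity) (by positivity)
  have h2 : s^6 * (s+t) ≤ s^5 * (s+t) := by
    apply mul_le_mul_of_nonneg_right _ (by positivity)
    exact pow_le_pow_of_le_one s0.le hs1 (by norm_num)
  have h3 : 2 * s^3 * (s/2) * (s * (s+t)) ≤ 2 * s^3 * t * (s+t)^2 := by
    apply mul_le_mul _ _ (by positivity) (by positivity)
    · apply mul_le_mul_of_nonneg_left hts (by positivity)
    · rw [pow_two]; apply mul_le_mul_of_nonneg_right _ (by positivity); linarith
  have h4 : 2 * s^3 * (s/2) * (s * (s+t)) = s^5 * (s+t) := by ring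
  have h5 : 0 ≤ s^5 * (s+t) := by positivity
  nlinarith

lemma aux_moment : ∃ C > 0, ∀ a : ℝ, 0 < a → a ≤ 1 →
    |(∑' k : ℤ, ((k:ℝ) + 1/2)^2 * Real.exp (-(a * ((k:ℝ) + 1/2)^2))) -
      Real.sqrt Real.pi / (2 * (a * Real.sqrt a))| ≤ C := by
  obtain ⟨C, hC, hth⟩ := aux_theta
  refine ⟨6 * Real.sqrt Real.pi + 2 * C * 9, by positivity, fun a ha ha1 => ?_⟩
  set d := a^3/2 with hd
  have ha3 : 0 < a^3 := by positivity
  have h3 : a^3 ≤ a := by nlinarith [mul_nonneg ha.le (sub_nonneg.2 ha1), mul_nonneg (sq_nonneg a) (sub_nonneg.2 ha1)]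
  have d0 : 0 < d := by positivity
  have hsp : 0 < Real.sqrt Real.pi := Real.sqrt_pos.2 Real.pi_pos
  have S0 := aux_summable0 a ha
  have Sm := aux_summable0 (a - d) (by linarith)
  have Sp := aux_summable0 (a + d) (by linarith)
  have S2 := aux_summable2 a ha
  have T0 := abs_le.1 (hth a ha (by linarith))
  have Tm := abs_le.1 (hth (a - d) (by linarith) (by linarith))
  have Tp := abs_le.1 (hth (a + d) (by linarith) (by linarith))
  have Im := abs_le.1 (aux_inv_sqrt a d ha ha1 le_rfl (by linarith))
  have Ip := abs_le.1 (aux_inv_sqrt a (-d) ha ha1 (by linarith) le_rfl)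
  rw [abs_neg, sub_neg_eq_add] at Ip
  rw [abs_of_pos d0] at Im Ip
  have pm : (a - d)^3 ≤ a^3 := pow_le_pow_left₀ (by linarith) (by linarith) 3
  have pp : (a + d)^3 ≤ 8 * a^3 := by
    calc (a+d)^3 ≤ (2*a)^3 := pow_le_pow_left₀ (by linarith) (by linarith) 3
      _ = _ := by ring
  -- upper comparison
  have U : d * (∑' k : ℤ, ((k:ℝ) + 1/2)^2 * Real.exp (-(a * ((k:ℝ) + 1/2)^2))) ≤
      (∑' k : ℤ, Real.exp (-((a-d) * ((k:ℝ) + 1/2)^2))) -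
        ∑' k : ℤ, Real.exp (-(a * ((k:ℝ) + 1/2)^2)) := by
    rw [← tsum_mul_left, ← Sm.tsum_sub S0]
    refine Summable.tsum_le_tsum (fun k => ?_) (S2.mul_left d) (Sm.sub S0)
    set x := ((k:ℝ)+1/2)^2
    have e : Real.exp (-((a-d)*x)) = Real.exp (-(a*x)) * Real.exp (d*x) := by
      rw [← Real.exp_add]; ring_nf
    rw [e]
    nlinarith [Real.add_one_le_exp (d*x), Real.exp_pos (-(a*x))]
  have V : (∑' k : ℤ, Real.exp (-(a * ((k:ℝ) + 1/2)^2))) -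
        (∑' k : ℤ, Real.exp (-((a+d) * ((k:ℝ) + 1/2)^2))) ≤
      d * (∑' k : ℤ, ((k:ℝ) + 1/2)^2 * Real.exp (-(a * ((k:ℝ) + 1/2)^2))) := by
    rw [← tsum_mul_left, ← S0.tsum_sub Sp]
    refine Summable.tsum_le_tsum (fun k => ?_) (S0.sub Sp) (S2.mul_left d)
    set x := ((k:ℝ)+1/2)^2
    have e : Real.exp (-((a+d)*x)) = Real.exp (-(a*x)) * Real.exp (-(d*x)) := by
      rw [← Real.exp_add]; ring_nf
    rw [e]
    nlinarith [Real.add_one_le_exp (-(d*x)), Real.exp_pos (-(a*x))]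
  set M := ∑' k : ℤ, ((k:ℝ) + 1/2)^2 * Real.exp (-(a * ((k:ℝ) + 1/2)^2))
  set p := Real.sqrt Real.pi
  have em : p / Real.sqrt (a-d) - p / Real.sqrt a - d * (p / (2 * (a * Real.sqrt a))) =
      p * (1 / Real.sqrt (a - d) - 1 / Real.sqrt a - d / (2 * (a * Real.sqrt a))) := by ring
  have ep : p / Real.sqrt (a+d) - p / Real.sqrt a + d * (p / (2 * (a * Real.sqrt a))) =
      p * (1 / Real.sqrt (a + d) - 1 / Real.sqrt a - (-d) / (2 * (a * Real.sqrt a))) := by ring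
  have bm := mul_le_mul_of_nonneg_left Im.2 hsp.le
  have bp := mul_le_mul_of_nonneg_left Ip.2 hsp.le
  rw [← em] at bm
  rw [← ep] at bp
  have qm := mul_le_mul_of_nonneg_left pm hC.le
  have qp := mul_le_mul_of_nonneg_left pp hC.le
  have ed : C * a^3 = 2 * C * d := by rw [hd]; ring
  rw [abs_le]
  constructor
  · have : 0 ≤ d * (M - p / (2 * (a * Real.sqrt a)) + (6 * p + 2 * C * 9)) := by nlinarith
    have := nonneg_of_mul_nonneg_right this d0
    linarith
  · have : 0 ≤ d * ((6 * p + 2 * C * 9) - (M - p / (2 * (a * Real.sqrt a)))) := by nlinarith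
    have := nonneg_of_mul_nonneg_right this d0
    linarith

set_option maxHeartbeats 2000000

lemma aux_term (q h A : ℝ) (hq0 : 0 < q) (hq1 : q ≤ 1) (hh0 : 0 < h) (hh1 : h ≤ 1/4)
    (hA : A = 2 * h^2 / (1 - h)) (hA3 : A ≤ 3 * h^2) (k : ℤ) :
    |ck h q k * ck h q (k+1) -
      Real.exp (-(2 * h / q) - h * q / 2) * (A * Real.exp (-(A * (q/4 + 1/q) / 2)) *
        ((q * ((k:ℝ)+1/2)^2 + (1/q - q/4)) *
          Real.exp (-((2 * h * q + A * q / 2) * ((k:ℝ)+1/2)^2))))| ≤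
      ((8/q + 27*27/q^3/8 * (Real.exp 1 * (24 / (2 * q)^4))) * h^2) *
        (1 / (1 + ((k:ℝ)+1/2)^2)) := by
  have hA0 : 0 < A := by rw [hA]; apply div_pos <;> nlinarith
  set m : ℝ := (k:ℝ)+1/2 with hm
  have hkm : (k:ℝ) = m - 1/2 := by rw [hm]; ring
  have hkm' : ((k+1:ℤ):ℝ) = m + 1/2 := by push_cast; rw [hm]; ring
  set E := Real.exp (-(2 * h / q) - h * q / 2) with hE
  have hE0 : 0 < E := Real.exp_pos _
  have hE1 : E ≤ 1 := by
    apply Real.exp_le_one_iff.2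
    have : 0 < 2 * h / q := by positivity
    have : 0 < h * q := by positivity
    linarith
  set w := q * m^2 + (1/q - q/4) with hw
  have hqi : 1 ≤ 1/q := by rw [le_div_iff₀ hq0]; linarith
  have hw1 : q/2 * (1 + m^2) ≤ w := by nlinarith [sq_nonneg m]
  have hw0 : 0 < w := lt_of_lt_of_le (by positivity) hw1
  set u := q * (m - 1/2)^2 + 1/q with hu
  set v := q * (m + 1/2)^2 + 1/q with hv
  have hu0 : 0 < u := by positivity
  have hv0 : 0 < v := by positivity
  have huv : u * v = w^2 + 1 := by
    rw [hu, hv, hw]; field_simp; ring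
  have huvs : u + v = 2 * (q * m^2) + (q/2 + 2/q) := by rw [hu, hv]; ring
  have huvb : u + v ≤ 3/q * (1 + m^2) := by
    rw [huvs]
    have h1 : 2/q = 2 * (1/q) := by ring
    have h2 : 3/q = 3 * (1/q) := by ring
    rw [h1, h2]
    nlinarith [sq_nonneg m, mul_le_mul_of_nonneg_right hqi (sq_nonneg m), mul_le_mul_of_nonneg_right hq1 (sq_nonneg m)]
  have hsq : Real.sqrt ((A*u) * (A*v)) = A * Real.sqrt (u*v) := by
    rw [show (A*u)*(A*v) = A^2 * (u*v) by ring, Real.sqrt_mul (by positivity), Real.sqrt_sq hA0.le]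
  have hs1 : w ≤ Real.sqrt (u*v) := by
    apply Real.le_sqrt_of_sq_le; linarith
  have hs2 : Real.sqrt (u*v) ≤ w + 1/w := by
    apply Real.sqrt_le_iff.2
    refine ⟨by positivity, ?_⟩
    have : (w + 1/w)^2 = w^2 + 2 + (1/w)^2 := by field_simp; ring
    rw [this, huv]; nlinarith [sq_nonneg (1/w)]
  have lo := aux_lower (A*u) (A*v) (by positivity) (by positivity)
  have up := aux_upper (A*u) (A*v) (by positivity) (by positivity)
  rw [hsq] at lo up
  have hck : ck h q k * ck h q (k+1) =
      E * (Real.exp (-(2*h*q*m^2)) *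
        (Real.sqrt (1 - Real.exp (-(A*u))) * Real.sqrt (1 - Real.exp (-(A*v))))) := by
    unfold ck
    rw [hkm', hkm, ← hA, ← hu, ← hv]
    have : Real.exp (-(h * q * (m - 1/2)^2) - h/q) * Real.exp (-(h * q * (m + 1/2)^2) - h/q) =
        E * Real.exp (-(2*h*q*m^2)) := by
      rw [hE, ← Real.exp_add, ← Real.exp_add]; congr 1; ring
    rw [← mul_assoc E, ← this]; ring
  clear_value E w u v
  set G := Real.exp (-(2*h*q*m^2)) with hG
  have hG0 : 0 < G := Real.exp_pos _
  have hG1 : G ≤ 1 := by apply Real.exp_le_one_iff.2; have : 0 ≤ 2*h*q*m^2 := by positivity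
                         linarith
  set H := Real.exp (-((A*u + A*v)/4)) with hH
  have hH0 : 0 < H := Real.exp_pos _
  have hH1 : H ≤ 1 := by apply Real.exp_le_one_iff.2; have : 0 ≤ A*u + A*v := by positivity
                         linarith
  have hmain : A * Real.exp (-(A * (q/4 + 1/q) / 2)) *
        (w * Real.exp (-((2 * h * q + A * q / 2) * m^2))) = G * (A * w * H) := by
    have : Real.exp (-(A * (q/4 + 1/q) / 2)) * Real.exp (-((2 * h * q + A * q / 2) * m^2)) = G * H := by
      rw [hG, hH, ← Real.exp_add, ← Real.exp_add, ← mul_add, huvs]; congr 1; ring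
    calc _ = A * w * (Real.exp (-(A * (q/4 + 1/q) / 2)) * Real.exp (-((2 * h * q + A * q / 2) * m^2))) := by ring
      _ = _ := by rw [this]; ring
  rw [hmain, hck, ← mul_sub, abs_mul, abs_of_pos hE0, ← mul_sub, abs_mul, abs_of_pos hG0]
  set Q := Real.sqrt (1 - Real.exp (-(A*u))) * Real.sqrt (1 - Real.exp (-(A*v)))
  clear_value G H Q
  have hAH : 0 < A * H := by positivity
  have d1 : 0 ≤ Q - A * w * H := by
    have h2 := mul_le_mul_of_nonneg_left hs1 hAH.le
    have h3 : A * H * Real.sqrt (u*v) = A * Real.sqrt (u*v) * H := by ring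
    have h4 : A * H * w = A * w * H := by ring
    linarith
  have d2 : Q - A * w * H ≤ A * (1/w) + (A*u+A*v)^3/8 := by
    have h1 : A * H * (1/w) ≤ A * (1/w) := by
      exact mul_le_mul_of_nonneg_right (mul_le_of_le_one_right hA0.le hH1) (by positivity)
    have h2 := mul_le_mul_of_nonneg_left hs2 hAH.le
    have h3 : A * H * Real.sqrt (u*v) = A * Real.sqrt (u*v) * H := by ring
    have h4 : A * H * (w + 1/w) = A * w * H + A * H * (1/w) := by ring
    linarith
  rw [abs_of_nonneg d1]
  have t0 : 0 < 1 + m^2 := by positivity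
  have b1 : G * (A * (1/w)) ≤ 4/q * h^2 * (1/(1+m^2)) * 2 := by
    have h1 : 1/w ≤ 1 / (q/2 * (1+m^2)) := one_div_le_one_div_of_le (by positivity) hw1
    calc G * (A * (1/w)) ≤ 1 * (A * (1/w)) := mul_le_mul_of_nonneg_right hG1 (by positivity)
      _ ≤ 1 * ((4 * h^2) * (1 / (q/2 * (1+m^2)))) := by
        rw [one_mul, one_mul]
        exact mul_le_mul (by linarith [sq_nonneg h]) h1 (by positivity) (by positivity)
      _ = _ := by field_simp
  have b2 : G * ((A*u+A*v)^3/8) ≤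
      27*27/q^3/8 * (Real.exp 1 * (24 / (2 * q)^4)) * h^2 * (1/(1+m^2)) := by
    have g := aux_gauss_le 3 (2*h*q) m (by positivity)
    rw [← hG] at g
    have e1 : Real.exp (2*h*q) ≤ Real.exp 1 := by
      apply Real.exp_le_exp.2
      have : h * q ≤ 1/4 * 1 := mul_le_mul hh1 hq1 hq0.le (by norm_num)
      linarith
    have c1 : A*u+A*v ≤ 3*h^2 * (3/q * (1+m^2)) := by
      rw [← mul_add]; exact mul_le_mul hA3 huvb (by positivity) (by positivity)
    have c2 : (A*u+A*v)^3 ≤ (3*h^2 * (3/q * (1+m^2)))^3 :=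
      pow_le_pow_left₀ (by positivity) c1 3
    calc G * ((A*u+A*v)^3/8) ≤ G * ((3*h^2 * (3/q * (1+m^2)))^3/8) := by gcongr
      _ = 27*27/q^3/8 * h^6 * ((1+m^2)^3 * G) := by ring
      _ ≤ 27*27/q^3/8 * h^6 * (Real.exp (2*h*q) * ((3+1).factorial / (2*h*q)^(3+1)) * (1/(1+m^2))) := by
        apply mul_le_mul_of_nonneg_left g (by positivity)
      _ ≤ 27*27/q^3/8 * h^6 * (Real.exp 1 * ((3+1).factorial / (2*h*q)^(3+1)) * (1/(1+m^2))) := by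
        gcongr
      _ = _ := by
        norm_num [Nat.factorial]
        field_simp
  have hb : G * (Q - A*w*H) ≤ G * (A * (1/w)) + G * ((A*u+A*v)^3/8) := by
    rw [← mul_add]; exact mul_le_mul_of_nonneg_left d2 hG0.le
  have hb0 : 0 ≤ G * (Q - A*w*H) := mul_nonneg hG0.le d1
  have b1' : 4/q * h^2 * (1/(1+m^2)) * 2 = 8/q * h^2 * (1/(1+m^2)) := by ring
  have hE2 : E * (G * (Q - A*w*H)) ≤ 1 * (G * (Q - A*w*H)) := mul_le_mul_of_nonneg_right hE1 hb0
  rw [add_mul, add_mul]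
  linarith

lemma aux_tau (e t : ℝ) (he : 0 ≤ e) (he1 : e ≤ 1) (ht : 0 < t) (ht2 : t^2 = 1 + e) :
    |1/t^3 - 1 + 3*e/2| ≤ 4*e^2 ∧ |1/t - 1| ≤ e ∧ 1/t^3 ≤ 1 ∧ 1/t ≤ 1 := by
  have t1 : 1 ≤ t := by nlinarith
  have tu : t ≤ 1 + e/2 := by nlinarith [sq_nonneg (t - (1+e/2)), sq_nonneg e]
  have tl : 1 + e/2 - e^2/2 ≤ t := by
    refine le_trans (le_abs_self _) (abs_le_of_sq_le_sq ?_ ht.le)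
    rw [ht2]
    nlinarith [pow_nonneg he 3, pow_nonneg he 2, mul_nonneg (pow_nonneg he 3) (sub_nonneg.2 he1)]
  have t3 : t^3 = (1+e)*t := by rw [← ht2]; ring
  have p3 : 0 < t^3 := by positivity
  have i1 : 1/t ≤ 1 := by rw [div_le_iff₀ ht]; linarith
  have i3 : 1/t^3 ≤ 1 := by rw [div_le_iff₀ p3, one_mul]; exact one_le_pow₀ t1
  have a1 : 1 - e ≤ 1/t := by rw [le_div_iff₀ ht]; nlinarith
  have a3 : 1 - 3*e/2 ≤ 1/t^3 := by
    rw [le_div_iff₀ p3, t3]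
    rcases le_total (1 - 3*e/2) 0 with h | h
    · have : 0 ≤ (1+e)*t := by positivity
      nlinarith
    · have : (1+e)*t ≤ (1+e)*(1+e/2) := by gcongr
      have := mul_le_mul_of_nonneg_left this h
      nlinarith [pow_nonneg he 3, pow_nonneg he 2]
  have b3 : 1/t^3 ≤ 1 - 3*e/2 + 4*e^2 := by
    rw [div_le_iff₀ p3, t3]
    have h0 : 0 ≤ 1 - 3*e/2 + 4*e^2 := by nlinarith [sq_nonneg (e - 3/16)]
    have : (1+e)*(1 + e/2 - e^2/2) ≤ (1+e)*t := by gcongr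
    have := mul_le_mul_of_nonneg_left this h0
    have e5 : e^5 ≤ e^2 * 1 := by
      calc e^5 = e^2 * e^3 := by ring
        _ ≤ e^2 * 1 := by gcongr; exact pow_le_one₀ he he1
    have e5' : e^5 ≤ e^3 * 1 := by
      calc e^5 = e^3 * e^2 := by ring
        _ ≤ e^3 * 1 := by gcongr; exact pow_le_one₀ he he1
    nlinarith [pow_nonneg he 3, pow_nonneg he 2, pow_nonneg he 4]
  refine ⟨?_, ?_, i3, i1⟩
  · rw [abs_le]; constructor <;> nlinarith [sq_nonneg e]
  · rw [abs_le]; constructor <;> linarith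

lemma aux_main (q h A a B : ℝ) (hq0 : 0 < q) (hq1 : q ≤ 1) (hh0 : 0 < h) (hh1 : h ≤ 1/4)
    (hA : A = 2 * h^2 / (1 - h)) (hA3 : A ≤ 3 * h^2) (ha : a = 2 * h * q + A * q / 2)
    (hB : B = Real.exp (-(A * (q/4 + 1/q) / 2))) :
    |A * B * (q * (Real.sqrt Real.pi / (2 * (a * Real.sqrt a))) +
        (1/q - q/4) * (Real.sqrt Real.pi / Real.sqrt a)) -
      1 / (1 - h) * Real.sqrt (Real.pi / (8 * q)) *
            (Real.sqrt h +
              ((1 - h) * (16 - 4 * q ^ 2) - 3 * q) / (4 * q * (1 - h)) * (h * Real.sqrt h))| ≤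
      (2 * (Real.sqrt Real.pi / (2 * Real.sqrt (2*q))) * (4 + 4/q + (1 + 4/q) * (3 * (q/4+1/q)))) * h^2 := by
  have h1 : 0 < 1 - h := by linarith
  have hA0 : 0 < A := by rw [hA]; positivity
  set e := h / (2 * (1-h)) with he
  have he0 : 0 < e := by positivity
  have heh : e ≤ h := by rw [he, div_le_iff₀ (by positivity)]; nlinarith
  set t := Real.sqrt (1 + e) with ht
  have t0 : 0 < t := Real.sqrt_pos.2 (by linarith)
  have t2 : t^2 = 1 + e := Real.sq_sqrt (by linarith)
  set s := Real.sqrt h with hs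
  have s0 : 0 < s := Real.sqrt_pos.2 hh0
  have s2 : s^2 = h := Real.sq_sqrt hh0.le
  set r := Real.sqrt (2*q) with hr
  have r0 : 0 < r := Real.sqrt_pos.2 (by positivity)
  have r2 : r^2 = 2*q := Real.sq_sqrt (by positivity)
  set p := Real.sqrt Real.pi with hp
  have p0 : 0 < p := Real.sqrt_pos.2 Real.pi_pos
  have hs1 : s ≤ 1 := by nlinarith
  have haf : a = (s*r*t)^2 := by
    rw [mul_pow, mul_pow, s2, r2, t2, ha, hA, he]; field_simp
  have hsa : Real.sqrt a = s*r*t := by rw [haf]; exact Real.sqrt_sq (by positivity)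
  have hpq : Real.sqrt (Real.pi / (8*q)) = p / (2*r) := by
    rw [Real.sqrt_div Real.pi_pos.le, show 8*q = (2*r)^2 by rw [mul_pow, r2]; ring,
      Real.sqrt_sq (by positivity)]
  obtain ⟨k1, k2, k3, k4⟩ := aux_tau e t he0.le (by linarith) t0 t2
  set N := q * (p / (2 * (a * Real.sqrt a))) + (1/q - q/4) * (p / Real.sqrt a) with hN
  set D := p / (2*r) with hD
  have hD0 : 0 < D := by positivity
  have hAN : A * N = 1/(1-h) * D * (s * (1/t^3) + (4/q - q) * (s^3 * (1/t))) := by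
    have hq' : q = r^2/2 := by rw [r2]; ring
    rw [hN, hsa, haf, hA, ← s2, hD]
    have : (1 - s^2) ≠ 0 := by rw [s2]; exact h1.ne'
    rw [hq']
    field_simp
    ring
  have hT : 1/(1-h) * D * (s + ((1 - h) * (16 - 4 * q ^ 2) - 3 * q) / (4 * q * (1 - h)) * (h * s)) =
      1/(1-h) * D * (s * (1 - 3*e/2) + (4/q - q) * s^3) := by
    rw [show s^3 = h*s by rw [← s2]; ring, he]
    field_simp
    ring
  have hqq : 0 ≤ 4/q - q := by
    have : 4 ≤ 4/q := by rw [le_div_iff₀ hq0]; linarith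
    linarith
  have hinv : 1/(1-h) ≤ 2 := by rw [div_le_iff₀ h1]; linarith
  have hinv0 : 0 < 1/(1-h) := by positivity
  have s3 : s^3 ≤ h := by
    rw [← s2]; exact pow_le_pow_of_le_one s0.le hs1 (by norm_num)
  have f1 : |A * N - 1/(1-h) * D * (s * (1 - 3*e/2) + (4/q - q) * s^3)| ≤
      2 * D * ((4 + 4/q) * h^2) := by
    rw [hAN, ← mul_sub, abs_mul, abs_of_pos (show 0 < 1/(1-h) * D by positivity)]
    apply mul_le_mul _ _ (abs_nonneg _) (by positivity)
    · exact mul_le_mul_of_nonneg_right hinv hD0.le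
    · have : s * (1/t^3) + (4/q - q) * (s^3 * (1/t)) - (s * (1 - 3*e/2) + (4/q - q) * s^3) =
        s * (1/t^3 - 1 + 3*e/2) + (4/q - q) * (s^3 * (1/t - 1)) := by ring
      rw [this]
      refine (abs_add_le _ _).trans ?_
      rw [abs_mul, abs_mul, abs_mul, abs_of_pos s0, abs_of_nonneg hqq, abs_of_pos (pow_pos s0 3)]
      have x1 : s * |1/t^3 - 1 + 3*e/2| ≤ 1 * (4 * h^2) := by
        apply mul_le_mul hs1 (k1.trans _) (abs_nonneg _) (by norm_num)
        nlinarith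
      have x2 : s^3 * |1/t - 1| ≤ h * h := by
        apply mul_le_mul s3 (k2.trans heh) (abs_nonneg _) hh0.le
      have x3 : (4/q - q) * (s^3 * |1/t - 1|) ≤ 4/q * (h*h) := by
        apply mul_le_mul (by linarith) x2 (by positivity) (by positivity)
      nlinarith
  have hN0 : 0 ≤ A * N := by rw [hAN]; positivity
  have hN1 : A * N ≤ 2 * D * (1 + 4/q) := by
    rw [hAN]
    apply mul_le_mul _ _ (by positivity) (by positivity)
    · exact mul_le_mul_of_nonneg_right hinv hD0.le
    · have x1 : s * (1/t^3) ≤ 1 * 1 := mul_le_mul hs1 k3 (by positivity) (by norm_num)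
      have x2 : s^3 * (1/t) ≤ 1 * 1 := mul_le_mul (by linarith) k4 (by positivity) (by norm_num)
      have x3 : (4/q - q) * (s^3 * (1/t)) ≤ 4/q * (1*1) :=
        mul_le_mul (by linarith) x2 (by positivity) (by positivity)
      linarith
  have hBl : 1 - A * (q/4 + 1/q) / 2 ≤ B := by
    have := Real.add_one_le_exp (-(A * (q/4 + 1/q) / 2)); rw [hB]; linarith
  have hBu : B ≤ 1 := by
    rw [hB]; apply Real.exp_le_one_iff.2
    have : 0 < A * (q/4 + 1/q) := by positivity
    linarith
  have f2 : A * N * (1 - B) ≤ 2 * D * (1 + 4/q) * (3 * h^2 * (q/4 + 1/q)) := by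
    apply mul_le_mul hN1 _ (by linarith) (by positivity)
    have : A * (q/4 + 1/q) ≤ 3 * h^2 * (q/4+1/q) := by gcongr
    have : 0 ≤ A * (q/4 + 1/q) := by positivity
    linarith
  rw [hpq, hT]
  have hf := abs_le.1 f1
  have f3 : 0 ≤ A * N * (1 - B) := mul_nonneg hN0 (by linarith)
  have f4 : 0 ≤ 2 * D * (1 + 4/q) * (3 * h^2 * (q/4 + 1/q)) := by positivity
  have e1 : A * B * N = A * N - A * N * (1 - B) := by ring
  have e2 : 2 * D * (4 + 4/q + (1 + 4/q) * (3 * (q/4+1/q))) * h^2 =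
      2 * D * ((4 + 4/q) * h^2) + 2 * D * (1 + 4/q) * (3 * h^2 * (q/4 + 1/q)) := by ring
  rw [abs_le, e1, e2]
  constructor <;> linarith

/-- Asymptotics of the first trigonometric moment `∑ₖ c_k c_{k+1}` as `h → 0` for fixed `q`. -/
theorem trig_moment_asymptotics_h (q : ℝ) (hq : q ∈ Set.Ioc (0:ℝ) 1) :
    ∃ K > 0, ∃ h₀ ∈ Set.Ioc (0:ℝ) (1/2), ∀ h ∈ Set.Ioo (0:ℝ) h₀,
      |(∑' k : ℤ, ck h q k * ck h q (k + 1)) -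
          Real.exp (-(2 * h / q) - h * q / 2) / (1 - h) * Real.sqrt (Real.pi / (8 * q)) *
            (Real.sqrt h +
              ((1 - h) * (16 - 4 * q ^ 2) - 3 * q) / (4 * q * (1 - h)) * (h * Real.sqrt h))| ≤
        K * (h ^ 2 * |Real.log h|) := by
  obtain ⟨hq0, hq1⟩ := hq
  obtain ⟨C0, hC0, th⟩ := aux_theta
  obtain ⟨C2, hC2, mo⟩ := aux_moment
  set W := ∑' k : ℤ, 1 / (1 + ((k:ℝ)+1/2)^2) with hW
  have hW0 : 0 ≤ W := tsum_nonneg (fun k => by positivity)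
  set K1 := 8/q + 27*27/q^3/8 * (Real.exp 1 * (24 / (2 * q)^4)) with hK1
  have hK10 : 0 < K1 := by positivity
  set K3 := 2 * (Real.sqrt Real.pi / (2 * Real.sqrt (2*q))) * (4 + 4/q + (1 + 4/q) * (3 * (q/4+1/q))) with hK3
  have hK30 : 0 ≤ K3 := by positivity
  set K2 := 3 * (C2 + 1/q * C0) with hK2
  have hK20 : 0 < K2 := by positivity
  refine ⟨K1 * W + K2 + K3, by positivity, 1/4, by norm_num, fun h hh => ?_⟩
  obtain ⟨hh0, hh1⟩ := hh
  have h1 : 0 < 1 - h := by linarith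
  set A := 2 * h^2 / (1 - h) with hA
  have hA0 : 0 < A := by positivity
  have hA3 : A ≤ 3 * h^2 := by
    rw [hA, div_le_iff₀ h1]; nlinarith [sq_nonneg h]
  set a := 2 * h * q + A * q / 2 with ha
  have ha0 : 0 < a := by positivity
  have ha1 : a ≤ 1 := by
    have : A * q ≤ 3 * h^2 * 1 := mul_le_mul hA3 hq1 hq0.le (by positivity)
    nlinarith
  set B := Real.exp (-(A * (q/4 + 1/q) / 2)) with hB
  have hB0 : 0 < B := Real.exp_pos _
  have hB1 : B ≤ 1 := by
    apply Real.exp_le_one_iff.2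
    have : 0 < A * (q/4 + 1/q) := by positivity
    linarith
  set E := Real.exp (-(2 * h / q) - h * q / 2) with hE
  have hE0 : 0 < E := Real.exp_pos _
  have hE1 : E ≤ 1 := by
    apply Real.exp_le_one_iff.2
    have : 0 < 2 * h / q := by positivity
    have : 0 < h * q := by positivity
    linarith
  have main := aux_main q h A a B hq0 hq1 hh0 hh1.le hA hA3 ha hB
  rw [← hK3] at main
  have S0 := aux_summable0 a ha0
  have S2 := aux_summable2 a ha0
  set F0 := ∑' k : ℤ, Real.exp (-(a * ((k:ℝ) + 1/2)^2)) with hF0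
  set F2 := ∑' k : ℤ, ((k:ℝ) + 1/2)^2 * Real.exp (-(a * ((k:ℝ) + 1/2)^2)) with hF2
  have hG : HasSum (fun k : ℤ => E * (A * B * ((q * ((k:ℝ)+1/2)^2 + (1/q - q/4)) *
          Real.exp (-(a * ((k:ℝ)+1/2)^2))))) (E * (A * B * (q * F2 + (1/q - q/4) * F0))) := by
    refine HasSum.mul_left _ (HasSum.mul_left _ ?_)
    convert (S2.hasSum.mul_left q).add (S0.hasSum.mul_left (1/q - q/4)) using 2 with k
    ring
  have hterm : ∀ k : ℤ, ‖ck h q k * ck h q (k+1) - E * (A * B * ((q * ((k:ℝ)+1/2)^2 + (1/q - q/4)) *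
          Real.exp (-(a * ((k:ℝ)+1/2)^2))))‖ ≤ (K1 * h^2) * (1 / (1 + ((k:ℝ)+1/2)^2)) :=
    fun k => aux_term q h A hq0 hq1 hh0 hh1.le hA hA3 k
  have hbd := aux_summable_half.hasSum.mul_left (K1 * h^2)
  have hdiff := Summable.of_norm_bounded hbd.summable hterm
  have hdn := tsum_of_norm_bounded hbd hterm
  have hck : Summable fun k : ℤ => ck h q k * ck h q (k+1) := by
    have := hdiff.add hG.summable
    simpa using this
  rw [hck.tsum_sub hG.summable, hG.tsum_eq, Real.norm_eq_abs, ← hW] at hdn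
  set S := ∑' k : ℤ, ck h q k * ck h q (k+1)
  set p := Real.sqrt Real.pi
  set N := q * (p / (2 * (a * Real.sqrt a))) + (1/q - q/4) * (p / Real.sqrt a) with hN
  have m0 := th a ha0 (by linarith)
  have m2 := mo a ha0 ha1
  have hqi : 1 ≤ 1/q := by rw [le_div_iff₀ hq0]; linarith
  have hFN : |(q * F2 + (1/q - q/4) * F0) - N| ≤ C2 + 1/q * C0 := by
    have : (q * F2 + (1/q - q/4) * F0) - N = q * (F2 - p / (2 * (a * Real.sqrt a))) +
        (1/q - q/4) * (F0 - p / Real.sqrt a) := by rw [hN]; ring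
    rw [this]
    refine (abs_add_le _ _).trans ?_
    rw [abs_mul, abs_mul, abs_of_pos hq0, abs_of_nonneg (show 0 ≤ 1/q - q/4 by linarith)]
    have y1 : q * |F2 - p / (2 * (a * Real.sqrt a))| ≤ 1 * C2 :=
      mul_le_mul hq1 m2 (abs_nonneg _) (by norm_num)
    have y2 : (1/q - q/4) * |F0 - p / Real.sqrt a| ≤ 1/q * C0 := by
      apply mul_le_mul (by linarith) (m0.trans _) (abs_nonneg _) (by positivity)
      have : a^3 ≤ 1 := pow_le_one₀ ha0.le ha1
      exact mul_le_of_le_one_right hC0.le this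
    linarith
  have hmid : |E * (A * B * (q * F2 + (1/q - q/4) * F0)) - E * (A * B * N)| ≤ K2 * h^2 := by
    rw [← mul_sub, ← mul_sub, abs_mul, abs_mul, abs_of_pos hE0, abs_of_pos (mul_pos hA0 hB0)]
    calc _ ≤ 1 * ((3 * h^2 * 1) * (C2 + 1/q * C0)) := by
          apply mul_le_mul hE1 _ (by positivity) (by norm_num)
          apply mul_le_mul _ hFN (abs_nonneg _) (by positivity)
          exact mul_le_mul hA3 hB1 hB0.le (by positivity)
      _ = _ := by rw [hK2]; ring
  set T := 1 / (1 - h) * Real.sqrt (Real.pi / (8 * q)) *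
            (Real.sqrt h +
              ((1 - h) * (16 - 4 * q ^ 2) - 3 * q) / (4 * q * (1 - h)) * (h * Real.sqrt h)) with hT
  have hlast : |E * (A * B * N) - E * T| ≤ K3 * h^2 := by
    rw [← mul_sub, abs_mul, abs_of_pos hE0]
    calc _ ≤ 1 * (K3 * h^2) := mul_le_mul hE1 main (abs_nonneg _) (by norm_num)
      _ = _ := one_mul _
  have eT : E / (1 - h) * Real.sqrt (Real.pi / (8 * q)) *
            (Real.sqrt h +
              ((1 - h) * (16 - 4 * q ^ 2) - 3 * q) / (4 * q * (1 - h)) * (h * Real.sqrt h)) = E * T := by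
    rw [hT]; ring
  rw [eT]
  have hlog : 1 ≤ |Real.log h| := by
    have l1 : Real.log h ≤ -1 := by
      rw [Real.log_le_iff_le_exp hh0]
      have := Real.exp_one_lt_d9
      rw [Real.exp_neg]
      have h4 : (4:ℝ)⁻¹ ≤ (Real.exp 1)⁻¹ := by
        apply inv_anti₀ (Real.exp_pos 1); linarith
      linarith
    rw [abs_of_neg (by linarith)]; linarith
  have tot : |S - E * T| ≤ (K1 * W + K2 + K3) * h^2 := by
    have t1 := abs_le.1 hdn
    have t2 := abs_le.1 hmid
    have t3 := abs_le.1 hlast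
    rw [abs_le]
    constructor <;> linarith
  refine tot.trans ?_
  apply mul_le_mul_of_nonneg_left _ (by positivity)
  exact le_mul_of_one_le_right (sq_nonneg h) hlog
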